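/- arXiv:0711.1710 — 2 statements merged into one kernel-verified Lean document; each statement's English description precedes it below -/
import Mathlib

section
/- For every h > 0, the limit as (x₁,x₂) → (0,0) with 0 < x₁ < x₂ < h of the ratio det_{1≤j,k≤2}[p₂ʰ(1,x_j|x_k)] / det_{1≤j,k≤2}[p₁(1,x_j|x_k)] exists and equals ∑_{(n₁,n₂)∈ℤ²} e^{−2h²(n₁²+n₂²)} A_h(n₁,n₂), where A_h(n₁,n₂) = 1 − 16h²n₁² + 24h⁴n₁⁴ + 24h⁴n₁²n₂² − (32/3)h⁶n₁⁶ − 32h⁶n₁⁴n₂² + (128/3)h⁸n₁⁶n₂² − (128/3)h⁸n₁⁴n₂⁴. -/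
open MeasureTheory Filter Topology

/-- The one-dimensional heat kernel `p(t,y|x) = (2πt)^{-1/2} exp(-(y-x)²/(2t))`. -/
noncomputable def heatK (t y x : ℝ) : ℝ :=
  (2 * Real.pi * t) ^ (-(1 : ℝ) / 2) * Real.exp (-(y - x) ^ 2 / (2 * t))

/-- Absorbing kernel with one wall at the origin. -/
noncomputable def pOne (t y x : ℝ) : ℝ := heatK t y x - heatK t y (-x)

/-- Absorbing kernel with two walls, at the origin and at `h`. -/
noncomputable def pTwo (h t y x : ℝ) : ℝ :=
  ∑' n : ℤ, (heatK t y (x + 2 * h * n) - heatK t y (-x + 2 * h * n))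

/-- The polynomial `A_h(n₁,n₂)`. -/
noncomputable def Apoly (h : ℝ) (n₁ n₂ : ℤ) : ℝ :=
  1 - 16 * h ^ 2 * (n₁ : ℝ) ^ 2 + 24 * h ^ 4 * (n₁ : ℝ) ^ 4
    + 24 * h ^ 4 * (n₁ : ℝ) ^ 2 * (n₂ : ℝ) ^ 2
    - (32 / 3) * h ^ 6 * (n₁ : ℝ) ^ 6 - 32 * h ^ 6 * (n₁ : ℝ) ^ 4 * (n₂ : ℝ) ^ 2
    + (128 / 3) * h ^ 8 * (n₁ : ℝ) ^ 6 * (n₂ : ℝ) ^ 2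
    - (128 / 3) * h ^ 8 * (n₁ : ℝ) ^ 4 * (n₂ : ℝ) ^ 4

/-- The divided difference `(yⁿ - xⁿ) / (y - x)`, as a polynomial in `q = (x, y)`. -/
noncomputable def powDivDiff (n : ℕ) (q : ℝ × ℝ) : ℝ :=
  ∑ k ∈ Finset.range n, q.2 ^ k * q.1 ^ (n - 1 - k)

lemma sub_mul_powDivDiff (n : ℕ) (q : ℝ × ℝ) :
    (q.2 - q.1) * powDivDiff n q = q.2 ^ n - q.1 ^ n :=
  (Commute.all _ _).mul_geom_sum₂ n

lemma abs_pow_le_two_pow {x : ℝ} (hx : x ∈ Set.Icc (0 : ℝ) 1) (n : ℕ) : |x ^ n| ≤ 2 ^ n := by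
  rw [abs_of_nonneg (pow_nonneg hx.1 n)]
  exact (pow_le_one₀ hx.1 hx.2).trans (one_le_pow₀ one_le_two)

lemma abs_powDivDiff_le_two_pow {q : ℝ × ℝ} (h₁ : q.1 ∈ Set.Icc (0 : ℝ) 1)
    (h₂ : q.2 ∈ Set.Icc (0 : ℝ) 1) (n : ℕ) : |powDivDiff n q| ≤ 2 ^ n := by
  calc |powDivDiff n q| ≤ ∑ k ∈ Finset.range n, |q.2 ^ k * q.1 ^ (n - 1 - k)| :=
        Finset.abs_sum_le_sum_abs _ _
    _ ≤ ∑ _k ∈ Finset.range n, (1 : ℝ) := by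
        refine Finset.sum_le_sum fun k _ => ?_
        have h3 := pow_nonneg h₁.1 (n - 1 - k)
        have h4 := pow_nonneg h₂.1 k
        rw [abs_of_nonneg (mul_nonneg h4 h3)]
        exact mul_le_one₀ (pow_le_one₀ h₂.1 h₂.2) h3 (pow_le_one₀ h₁.1 h₁.2)
    _ = n := by simp
    _ ≤ 2 ^ n := by exact_mod_cast Nat.lt_two_pow_self.le

lemma tendsto_powDivDiff (n : ℕ) :
    Tendsto (powDivDiff n) (𝓝 (0, 0)) (𝓝 (if n = 1 then 1 else 0)) := by
  have hc : Continuous (powDivDiff n) := by unfold powDivDiff; fun_prop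
  convert! hc.tendsto (0, 0) using 2
  unfold powDivDiff
  rcases n with _ | _ | n
  · simp
  · simp
  · refine (Finset.sum_eq_zero fun k _ => ?_).symm
    rcases k with _ | k <;> simp

section Series

variable {ι : Type*} {c : ι → ℝ} {P Q : ι → ℕ}

lemma summable_of_abs_le_two_pow (hs : Summable fun i => |c i| * 2 ^ P i * 2 ^ Q i)
    {u v : ℕ → ℝ} (hu : ∀ n, |u n| ≤ 2 ^ n) (hv : ∀ n, |v n| ≤ 2 ^ n) :
    Summable fun i => c i * u (P i) * v (Q i) := by
  refine hs.of_norm_bounded fun i => ?_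
  rw [Real.norm_eq_abs, abs_mul, abs_mul]
  gcongr
  exacts [hu _, hv _]

lemma tendsto_tsum_of_abs_le_two_pow {α : Type*} {l : Filter α}
    (hs : Summable fun i => |c i| * 2 ^ P i * 2 ^ Q i)
    {u v : ℕ → α → ℝ} {a b : ℕ → ℝ} (hu : ∀ᶠ q in l, ∀ n, |u n q| ≤ 2 ^ n)
    (hv : ∀ᶠ q in l, ∀ n, |v n q| ≤ 2 ^ n) (ha : ∀ n, Tendsto (u n) l (𝓝 (a n)))
    (hb : ∀ n, Tendsto (v n) l (𝓝 (b n))) :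
    Tendsto (fun q => ∑' i, c i * u (P i) q * v (Q i) q) l
      (𝓝 (∑' i, c i * a (P i) * b (Q i))) := by
  refine tendsto_tsum_of_dominated_convergence hs
    (fun i => ((ha _).const_mul _).mul (hb _)) ?_
  filter_upwards [hu, hv] with q hu hv i
  rw [Real.norm_eq_abs, abs_mul, abs_mul]
  gcongr
  exacts [hu _, hv _]

/-- For `F X Y = ∑ cᵢ X ^ Pᵢ Y ^ Qᵢ`, the determinant `det F(X_j, X_k)` divided by the squared
Vandermonde determinant tends to the determinant of the low-order coefficients. -/
lemma tendsto_det_div_sq (hs : Summable fun i => |c i| * 2 ^ P i * 2 ^ Q i)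
    {F : ℝ → ℝ → ℝ} (hF : ∀ X Y, F X Y = ∑' i, c i * X ^ P i * Y ^ Q i) :
    Tendsto (fun q : ℝ × ℝ =>
        (F q.1 q.1 * F q.2 q.2 - F q.1 q.2 * F q.2 q.1) / (q.2 - q.1) ^ 2)
      (𝓝[{q : ℝ × ℝ | 0 < q.1 ∧ q.1 < q.2}] (0, 0))
      (𝓝 ((∑' i, c i * (if P i = 0 then 1 else 0) * (if Q i = 0 then 1 else 0))
          * (∑' i, c i * (if P i = 1 then 1 else 0) * (if Q i = 1 then 1 else 0))
        - (∑' i, c i * (if P i = 0 then 1 else 0) * (if Q i = 1 then 1 else 0))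
          * (∑' i, c i * (if P i = 1 then 1 else 0) * (if Q i = 0 then 1 else 0)))) := by
  set l := 𝓝[{q : ℝ × ℝ | 0 < q.1 ∧ q.1 < q.2}] ((0 : ℝ), (0 : ℝ))
  have hl : l ≤ 𝓝 (0, 0) := nhdsWithin_le_nhds
  have hmem : ∀ᶠ q in l, 0 < q.1 ∧ q.1 < q.2 := self_mem_nhdsWithin
  have hlt : ∀ᶠ q in l, q.2 < 1 :=
    hl ((isOpen_lt continuous_snd continuous_const).mem_nhds (by simp))
  have hI : ∀ᶠ q in l, q.1 ∈ Set.Icc (0 : ℝ) 1 ∧ q.2 ∈ Set.Icc (0 : ℝ) 1 ∧ q.1 < q.2 := by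
    filter_upwards [hmem, hlt] with q h h'
    exact ⟨⟨h.1.le, by linarith⟩, ⟨by linarith, h'.le⟩, h.2⟩
  have hp : ∀ᶠ q in l, ∀ n : ℕ, |q.1 ^ n| ≤ 2 ^ n :=
    hI.mono fun q h n => abs_pow_le_two_pow h.1 n
  have hd : ∀ᶠ q in l, ∀ n : ℕ, |powDivDiff n q| ≤ 2 ^ n :=
    hI.mono fun q h n => abs_powDivDiff_le_two_pow h.1 h.2.1 n
  have tp : ∀ n : ℕ, Tendsto (fun q : ℝ × ℝ => q.1 ^ n) l (𝓝 (if n = 0 then 1 else 0)) := by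
    intro n
    have hc : Continuous fun q : ℝ × ℝ => q.1 ^ n := by fun_prop
    convert! (hc.tendsto (0, 0)).mono_left hl using 2
    simp [zero_pow_eq]
  have td : ∀ n : ℕ, Tendsto (powDivDiff n) l (𝓝 (if n = 1 then 1 else 0)) :=
    fun n => (tendsto_powDivDiff n).mono_left hl
  refine Tendsto.congr' ?_
    (((tendsto_tsum_of_abs_le_two_pow hs hp hp tp tp).mul
      (tendsto_tsum_of_abs_le_two_pow hs hd hd td td)).sub
      ((tendsto_tsum_of_abs_le_two_pow hs hp hd tp td).mul
        (tendsto_tsum_of_abs_le_two_pow hs hd hp td tp)))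
  filter_upwards [hI] with q ⟨h₁, h₂, h₃⟩
  have s₁ := abs_pow_le_two_pow h₁
  have sd := abs_powDivDiff_le_two_pow h₁ h₂
  have e12 : F q.1 q.2 = F q.1 q.1
      + (q.2 - q.1) * ∑' i, c i * q.1 ^ P i * powDivDiff (Q i) q := by
    rw [hF, hF, ← tsum_mul_left, ← Summable.tsum_add (summable_of_abs_le_two_pow hs s₁ s₁)
      ((summable_of_abs_le_two_pow hs s₁ sd).mul_left _)]
    refine tsum_congr fun i => ?_
    linear_combination -(c i * q.1 ^ P i) * sub_mul_powDivDiff (Q i) q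
  have e21 : F q.2 q.1 = F q.1 q.1
      + (q.2 - q.1) * ∑' i, c i * powDivDiff (P i) q * q.1 ^ Q i := by
    rw [hF, hF, ← tsum_mul_left, ← Summable.tsum_add (summable_of_abs_le_two_pow hs s₁ s₁)
      ((summable_of_abs_le_two_pow hs sd s₁).mul_left _)]
    refine tsum_congr fun i => ?_
    linear_combination -(c i * q.1 ^ Q i) * sub_mul_powDivDiff (P i) q
  have e22 : F q.2 q.2 = F q.1 q.2
      + (q.2 - q.1) * (∑' i, c i * powDivDiff (P i) q * q.1 ^ Q i)
      + (q.2 - q.1) ^ 2 * ∑' i, c i * powDivDiff (P i) q * powDivDiff (Q i) q := by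
    have s₂ := abs_pow_le_two_pow h₂
    rw [hF, hF, ← tsum_mul_left, ← tsum_mul_left,
      ← Summable.tsum_add (summable_of_abs_le_two_pow hs s₁ s₂)
        ((summable_of_abs_le_two_pow hs sd s₁).mul_left _),
      ← Summable.tsum_add ((summable_of_abs_le_two_pow hs s₁ s₂).add
        ((summable_of_abs_le_two_pow hs sd s₁).mul_left _))
        ((summable_of_abs_le_two_pow hs sd sd).mul_left _)]
    refine tsum_congr fun i => ?_
    linear_combination -(c i * q.2 ^ Q i) * sub_mul_powDivDiff (P i) q
      - (c i * (q.2 - q.1) * powDivDiff (P i) q) * sub_mul_powDivDiff (Q i) q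
  have hne : q.2 - q.1 ≠ 0 := sub_ne_zero.2 h₃.ne'
  rw [eq_div_iff (pow_ne_zero 2 hne), ← hF, e22, e21, e12]
  ring

end Series

lemma Real.hasSum_exp_div_factorial (x : ℝ) :
    HasSum (fun n : ℕ => x ^ n / (n.factorial : ℝ)) (Real.exp x) := by
  rw [Real.exp_eq_exp_ℝ]
  exact NormedSpace.expSeries_div_hasSum_exp x

/-- The coefficient of `(xy)ᵏ yⁱ xʲ` in the expansion of `exp (x y + b y + a x)`. -/
noncomputable def expCoeff (b a : ℝ) (m : ℕ × ℕ × ℕ) : ℝ :=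
  1 / (m.1.factorial : ℝ) * (b ^ m.2.1 / (m.2.1.factorial : ℝ))
    * (a ^ m.2.2 / (m.2.2.factorial : ℝ))

lemma abs_expCoeff (b a : ℝ) (m : ℕ × ℕ × ℕ) : |expCoeff b a m| = expCoeff |b| |a| m := by
  simp [expCoeff, abs_mul, abs_div]

lemma hasSum_expCoeff (b a x y : ℝ) :
    HasSum (fun m : ℕ × ℕ × ℕ => expCoeff b a m * x ^ (m.1 + m.2.2) * y ^ (m.1 + m.2.1))
      (Real.exp (x * y + b * y + a * x)) := by
  have norm_summable (z : ℝ) : Summable fun n : ℕ => ‖z ^ n / (n.factorial : ℝ)‖ :=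
    (Real.hasSum_exp_div_factorial z).summable.norm
  have s₁ := (norm_summable (b * y)).mul_norm (norm_summable (a * x))
  have s₂ := (norm_summable (x * y)).mul_norm s₁
  have h₁ := (Real.hasSum_exp_div_factorial (b * y)).mul (Real.hasSum_exp_div_factorial (a * x))
    s₁.of_norm
  have h₂ := (Real.hasSum_exp_div_factorial (x * y)).mul h₁ s₂.of_norm
  rw [add_assoc, Real.exp_add, Real.exp_add]
  have e (m : ℕ × ℕ × ℕ) : expCoeff b a m * x ^ (m.1 + m.2.2) * y ^ (m.1 + m.2.1)
      = (x * y) ^ m.1 / (m.1.factorial : ℝ) * ((b * y) ^ m.2.1 / (m.2.1.factorial : ℝ)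
        * ((a * x) ^ m.2.2 / (m.2.2.factorial : ℝ))) := by
    simp only [expCoeff, mul_pow, pow_add]
    ring
  simpa only [e] using h₂

/-- The Gaussian weight `exp (-2 h² n²)`. -/
noncomputable def gaussWeight (h : ℝ) (n : ℤ) : ℝ := Real.exp (-2 * h ^ 2 * (n : ℝ) ^ 2)

lemma gaussWeight_pos (h : ℝ) (n : ℤ) : 0 < gaussWeight h n := Real.exp_pos _

lemma summable_abs_pow_mul_gaussWeight_mul_exp {h : ℝ} (hh : 0 < h) (s : ℝ) (k : ℕ) :
    Summable fun n : ℤ => |(n : ℝ)| ^ k * (gaussWeight h n * Real.exp (s * |(n : ℝ)|)) := by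
  have hT : 0 < 2 * h ^ 2 / Real.pi := by positivity
  convert! summable_pow_mul_jacobiTheta₂_term_bound (s / (2 * Real.pi)) hT k using 2 with n
  rw [gaussWeight, ← Real.exp_add]
  push_cast
  congr 2
  field_simp
  ring

lemma summable_gaussWeight_mul_pow {h : ℝ} (hh : 0 < h) (k : ℕ) :
    Summable fun n : ℤ => gaussWeight h n * (h ^ 2 * (n : ℝ) ^ 2) ^ k := by
  convert! (summable_abs_pow_mul_gaussWeight_mul_exp hh 0 (2 * k)).mul_left ((h ^ 2) ^ k)
    using 2 with n
  rw [pow_mul |(n : ℝ)|, sq_abs, mul_pow]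
  simp
  ring

/-- The index set of the expansion of the two-wall kernel: an image point and three exponents. -/
abbrev ImageIndex : Type := ℤ × ℕ × ℕ × ℕ

/-- The coefficients of the double power series `∑ₙ exp (-2h²n²) exp (x y + 2hn (y - x))`. -/
noncomputable def imageCoeff (h : ℝ) (i : ImageIndex) : ℝ :=
  gaussWeight h i.1 * expCoeff (2 * h * i.1) (-(2 * h * i.1)) i.2

/-- The exponent of `x`. -/
def ImageIndex.left (i : ImageIndex) : ℕ := i.2.1 + i.2.2.2

/-- The exponent of `y`. -/
def ImageIndex.right (i : ImageIndex) : ℕ := i.2.1 + i.2.2.1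

lemma summable_abs_imageCoeff {h : ℝ} (hh : 0 < h) {x y : ℝ} (hx : 0 ≤ x) (hy : 0 ≤ y) :
    Summable fun i : ImageIndex =>
      |imageCoeff h i| * x ^ i.left * y ^ i.right := by
  have hs (n : ℤ) : HasSum (fun m : ℕ × ℕ × ℕ => |imageCoeff h (n, m)|
        * x ^ ImageIndex.left (n, m) * y ^ ImageIndex.right (n, m))
      (gaussWeight h n * Real.exp (x * y + |2 * h * n| * y + |2 * h * n| * x)) := by
    convert! (hasSum_expCoeff |2 * h * n| |2 * h * n| x y).mul_left (gaussWeight h n) using 2 with m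
    simp only [imageCoeff, ImageIndex.left, ImageIndex.right, abs_mul, abs_expCoeff, abs_neg,
      abs_of_pos (gaussWeight_pos h n)]
    ring
  refine (summable_prod_of_nonneg fun i => by positivity).2 ⟨fun n => (hs n).summable, ?_⟩
  simp only [(hs _).tsum_eq]
  convert! (summable_abs_pow_mul_gaussWeight_mul_exp hh (2 * h * (x + y)) 0).mul_left
    (Real.exp (x * y)) using 2 with n
  rw [abs_mul, abs_of_pos (by positivity : 0 < 2 * h), pow_zero, one_mul, mul_left_comm,
    ← Real.exp_add]
  congr 2
  ring

/-- The function `∑ₙ exp (-2h²n²) exp (x y + 2hn (y - x))`. -/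
noncomputable def imageSum (h x y : ℝ) : ℝ :=
  ∑' n : ℤ, gaussWeight h n * Real.exp (x * y + 2 * h * n * y + -(2 * h * n) * x)

lemma summable_imageCoeff {h : ℝ} (hh : 0 < h) (x y : ℝ) :
    Summable fun i : ImageIndex => imageCoeff h i * x ^ i.left * y ^ i.right := by
  refine (summable_abs_imageCoeff hh (abs_nonneg x) (abs_nonneg y)).of_norm_bounded fun i => ?_
  simp

lemma hasSum_imageSum_fiber (h x y : ℝ) (n : ℤ) :
    HasSum (fun m : ℕ × ℕ × ℕ => imageCoeff h (n, m)
        * x ^ ImageIndex.left (n, m) * y ^ ImageIndex.right (n, m))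
      (gaussWeight h n * Real.exp (x * y + 2 * h * n * y + -(2 * h * n) * x)) := by
  convert! (hasSum_expCoeff (2 * h * n) (-(2 * h * n)) x y).mul_left (gaussWeight h n)
    using 2 with m
  simp only [imageCoeff, ImageIndex.left, ImageIndex.right]
  ring

lemma hasSum_imageSum {h : ℝ} (hh : 0 < h) (x y : ℝ) :
    HasSum (fun i : ImageIndex => imageCoeff h i * x ^ i.left * y ^ i.right)
      (imageSum h x y) := by
  have hs := summable_imageCoeff hh x y
  rw [imageSum, ← (hs.hasSum.prod_fiberwise (hasSum_imageSum_fiber h x y)).tsum_eq.symm]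
  exact hs.hasSum

lemma summable_imageSum {h : ℝ} (hh : 0 < h) (x y : ℝ) :
    Summable fun n : ℤ =>
      gaussWeight h n * Real.exp (x * y + 2 * h * n * y + -(2 * h * n) * x) :=
  ((summable_imageCoeff hh x y).hasSum.prod_fiberwise (hasSum_imageSum_fiber h x y)).summable

lemma imageSum_neg_neg (h x y : ℝ) : imageSum h (-x) (-y) = imageSum h x y := by
  rw [imageSum, ← (Equiv.neg ℤ).tsum_eq]
  refine tsum_congr fun n => ?_
  simp [gaussWeight]

lemma pTwo_eq_imageSum {h : ℝ} (hh : 0 < h) (x y : ℝ) :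
    pTwo h 1 y x = (2 * Real.pi * 1) ^ (-(1 : ℝ) / 2) * Real.exp (-(x ^ 2 + y ^ 2) / 2)
      * (imageSum h x y - imageSum h (-x) y) := by
  rw [imageSum, imageSum,
    ← Summable.tsum_sub (summable_imageSum hh x y) (summable_imageSum hh (-x) y),
    ← tsum_mul_left, pTwo]
  refine tsum_congr fun n => ?_
  simp only [heatK, gaussWeight, mul_sub (_ * _), mul_assoc ((2 * Real.pi * 1) ^ (-(1 : ℝ) / 2)),
    ← Real.exp_add]
  congr 3 <;> ring

/-- The coefficients of the part of the power series of `imageSum h x y - imageSum h (-x) y`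
that is odd in `x` and in `y`. -/
noncomputable def oddImageCoeff (h : ℝ) (i : ImageIndex) : ℝ :=
  if Odd i.left ∧ Odd i.right then 2 * imageCoeff h i else 0

lemma summable_oddImageCoeff {h : ℝ} (hh : 0 < h) :
    Summable fun i : ImageIndex =>
      |oddImageCoeff h i| * 2 ^ (i.left / 2) * 2 ^ (i.right / 2) := by
  refine ((summable_abs_imageCoeff hh zero_le_two zero_le_two).mul_left 2).of_norm_bounded
    fun i => ?_
  have h₁ : |oddImageCoeff h i| ≤ 2 * |imageCoeff h i| := by
    unfold oddImageCoeff
    split_ifs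
    · simp [abs_mul]
    · simp
  rw [Real.norm_of_nonneg (by positivity), ← mul_assoc, ← mul_assoc]
  gcongr <;> first | exact one_le_two | exact Nat.div_le_self _ _

lemma one_sub_neg_one_pow_mul_pow (x : ℝ) (n : ℕ) :
    x ^ n - (-x) ^ n = if Odd n then 2 * x * (x ^ 2) ^ (n / 2) else 0 := by
  rcases Nat.even_or_odd n with hn | hn
  · rw [hn.neg_pow, if_neg (Nat.not_odd_iff_even.2 hn), sub_self]
  · rw [hn.neg_pow, if_pos hn]
    nth_rewrite 1 [← Nat.two_mul_div_two_add_one_of_odd hn]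
    nth_rewrite 2 [← Nat.two_mul_div_two_add_one_of_odd hn]
    rw [pow_succ, pow_mul]
    ring

/-- The power series of `(imageSum h x y - imageSum h (-x) y) / (x y)` in `X = x²`, `Y = y²`. -/
noncomputable def imageSeries (h X Y : ℝ) : ℝ :=
  ∑' i : ImageIndex, oddImageCoeff h i * X ^ (i.left / 2) * Y ^ (i.right / 2)

lemma imageSum_sub_eq {h : ℝ} (hh : 0 < h) (x y : ℝ) :
    imageSum h x y - imageSum h (-x) y = x * y * imageSeries h (x ^ 2) (y ^ 2) := by
  have hs := (((hasSum_imageSum hh x y).sub (hasSum_imageSum hh (-x) y)).sub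
    ((hasSum_imageSum hh x (-y)).sub (hasSum_imageSum hh (-x) (-y)))).mul_left (1 / 2)
  have e : imageSum h x (-y) = imageSum h (-x) y := by
    simpa using (imageSum_neg_neg h x (-y)).symm
  rw [imageSum_neg_neg, e] at hs
  rw [imageSeries, ← tsum_mul_left]
  convert! hs.tsum_eq.symm using 1
  · ring
  · refine tsum_congr fun i => ?_
    have hf := congrArg₂ (· * ·) (one_sub_neg_one_pow_mul_pow x i.left)
      (one_sub_neg_one_pow_mul_pow y i.right)
    trans 1 / 2 * (imageCoeff h i * ((x ^ i.left - (-x) ^ i.left)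
      * (y ^ i.right - (-y) ^ i.right)))
    · rw [hf, oddImageCoeff]
      by_cases h₁ : Odd i.left <;> by_cases h₂ : Odd i.right <;> simp [h₁, h₂]
      ring
    · ring

/-- The moment `∑ₙ exp (-2h²n²) (h²n²)ᵏ`. -/
noncomputable def gaussMoment (h : ℝ) (k : ℕ) : ℝ :=
  ∑' n : ℤ, gaussWeight h n * (h ^ 2 * (n : ℝ) ^ 2) ^ k

lemma hasSum_gaussMoment {h : ℝ} (hh : 0 < h) (k : ℕ) :
    HasSum (fun n : ℤ => gaussWeight h n * (h ^ 2 * (n : ℝ) ^ 2) ^ k) (gaussMoment h k) :=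
  (summable_gaussWeight_mul_pow hh k).hasSum

lemma tsum_oddImageCoeff {h : ℝ} (hh : 0 < h) (r s : ℕ) :
    ∑' i : ImageIndex, oddImageCoeff h i * (if i.left / 2 = r then 1 else 0)
        * (if i.right / 2 = s then 1 else 0)
      = ∑' n : ℤ, gaussWeight h n * ∑ m ∈ Finset.range (2 * r + 2) ×ˢ
          Finset.range (2 * s + 2) ×ˢ Finset.range (2 * r + 2),
        if m.1 + m.2.2 = 2 * r + 1 ∧ m.1 + m.2.1 = 2 * s + 1 then
          2 * expCoeff (2 * h * n) (-(2 * h * n)) m else 0 := by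
  have hb (r n : ℕ) : |(if n = r then 1 else 0 : ℝ)| ≤ 2 ^ n := by
    have := one_le_pow₀ (one_le_two (α := ℝ)) (n := n)
    split_ifs <;> simp [this]
  have hs := summable_of_abs_le_two_pow (summable_oddImageCoeff hh) (hb r) (hb s)
  rw [hs.tsum_prod]
  refine tsum_congr fun n => ?_
  rw [Finset.mul_sum, ← tsum_eq_sum (L := .unconditional _)]
  · refine tsum_congr fun m => ?_
    have hm : (m.1 + m.2.2 = 2 * r + 1 ∧ m.1 + m.2.1 = 2 * s + 1) ↔
        (Odd (m.1 + m.2.2) ∧ Odd (m.1 + m.2.1)) ∧ (m.1 + m.2.2) / 2 = r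
          ∧ (m.1 + m.2.1) / 2 = s := by
      rw [Nat.odd_iff, Nat.odd_iff]
      omega
    simp only [hm, oddImageCoeff, imageCoeff, ImageIndex.left, ImageIndex.right]
    clear hm
    by_cases h₁ : Odd (m.1 + m.2.2) ∧ Odd (m.1 + m.2.1) <;> by_cases h₂ : (m.1 + m.2.2) / 2 = r <;>
      by_cases h₃ : (m.1 + m.2.1) / 2 = s <;> simp only [h₁, h₂, h₃] <;> simp
    ring
  · intro m hm
    rw [if_neg, mul_zero]
    simp only [Finset.mem_product, Finset.mem_range] at hm
    omega

lemma tsum_oddImageCoeff_zero_zero {h : ℝ} (hh : 0 < h) :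
    ∑' i : ImageIndex, oddImageCoeff h i * (if i.left / 2 = 0 then 1 else 0)
        * (if i.right / 2 = 0 then 1 else 0) = 2 * gaussMoment h 0 - 8 * gaussMoment h 1 := by
  rw [tsum_oddImageCoeff hh]
  refine HasSum.tsum_eq ?_
  convert! ((hasSum_gaussMoment hh 0).mul_left 2).sub ((hasSum_gaussMoment hh 1).mul_left 8)
    using 2 with n
  simp [Finset.sum_product, Finset.sum_range_succ, expCoeff, Nat.factorial]
  ring

lemma tsum_oddImageCoeff_zero_one {h : ℝ} (hh : 0 < h) :
    ∑' i : ImageIndex, oddImageCoeff h i * (if i.left / 2 = 0 then 1 else 0)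
        * (if i.right / 2 = 1 then 1 else 0)
      = 4 * gaussMoment h 1 - 16 / 3 * gaussMoment h 2 := by
  rw [tsum_oddImageCoeff hh]
  refine HasSum.tsum_eq ?_
  convert! ((hasSum_gaussMoment hh 1).mul_left 4).sub ((hasSum_gaussMoment hh 2).mul_left (16 / 3))
    using 2 with n
  simp [Finset.sum_product, Finset.sum_range_succ, expCoeff, Nat.factorial]
  ring

lemma tsum_oddImageCoeff_one_zero {h : ℝ} (hh : 0 < h) :
    ∑' i : ImageIndex, oddImageCoeff h i * (if i.left / 2 = 1 then 1 else 0)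
        * (if i.right / 2 = 0 then 1 else 0)
      = 4 * gaussMoment h 1 - 16 / 3 * gaussMoment h 2 := by
  rw [tsum_oddImageCoeff hh]
  refine HasSum.tsum_eq ?_
  convert! ((hasSum_gaussMoment hh 1).mul_left 4).sub ((hasSum_gaussMoment hh 2).mul_left (16 / 3))
    using 2 with n
  simp [Finset.sum_product, Finset.sum_range_succ, expCoeff, Nat.factorial]
  ring

lemma tsum_oddImageCoeff_one_one {h : ℝ} (hh : 0 < h) :
    ∑' i : ImageIndex, oddImageCoeff h i * (if i.left / 2 = 1 then 1 else 0)
        * (if i.right / 2 = 1 then 1 else 0)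
      = 1 / 3 * gaussMoment h 0 - 4 * gaussMoment h 1 + 8 * gaussMoment h 2
        - 32 / 9 * gaussMoment h 3 := by
  rw [tsum_oddImageCoeff hh]
  refine HasSum.tsum_eq ?_
  convert! ((((hasSum_gaussMoment hh 0).mul_left (1 / 3)).sub
    ((hasSum_gaussMoment hh 1).mul_left 4)).add ((hasSum_gaussMoment hh 2).mul_left 8)).sub
    ((hasSum_gaussMoment hh 3).mul_left (32 / 9)) using 2 with n
  simp [Finset.sum_product, Finset.sum_range_succ, expCoeff, Nat.factorial]
  ring

lemma hasSum_gaussMoment_mul {h : ℝ} (hh : 0 < h) (k l : ℕ) :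
    HasSum (fun n : ℤ × ℤ => gaussWeight h n.1 * (h ^ 2 * (n.1 : ℝ) ^ 2) ^ k
        * (gaussWeight h n.2 * (h ^ 2 * (n.2 : ℝ) ^ 2) ^ l))
      (gaussMoment h k * gaussMoment h l) := by
  have hs := (summable_gaussWeight_mul_pow hh k).norm.mul_norm
    (summable_gaussWeight_mul_pow hh l).norm
  exact (hasSum_gaussMoment hh k).mul (hasSum_gaussMoment hh l) hs.of_norm

lemma hasSum_Apoly {h : ℝ} (hh : 0 < h) :
    HasSum (fun n : ℤ × ℤ =>
        Real.exp (-2 * h ^ 2 * ((n.1 : ℝ) ^ 2 + (n.2 : ℝ) ^ 2)) * Apoly h n.1 n.2)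
      (gaussMoment h 0 * gaussMoment h 0 - 16 * (gaussMoment h 1 * gaussMoment h 0)
        + 24 * (gaussMoment h 2 * gaussMoment h 0) + 24 * (gaussMoment h 1 * gaussMoment h 1)
        - 32 / 3 * (gaussMoment h 3 * gaussMoment h 0) - 32 * (gaussMoment h 2 * gaussMoment h 1)
        + 128 / 3 * (gaussMoment h 3 * gaussMoment h 1)
        - 128 / 3 * (gaussMoment h 2 * gaussMoment h 2)) := by
  have H := hasSum_gaussMoment_mul hh
  convert! (((((((H 0 0).sub ((H 1 0).mul_left 16)).add ((H 2 0).mul_left 24)).add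
    ((H 1 1).mul_left 24)).sub ((H 3 0).mul_left (32 / 3))).sub ((H 2 1).mul_left 32)).add
    ((H 3 1).mul_left (128 / 3))).sub ((H 2 2).mul_left (128 / 3)) using 2 with n
  rw [mul_add, Real.exp_add, ← gaussWeight, ← gaussWeight, Apoly]
  ring

/-- The coefficients of the power series of `2 sinh (x y) / (x y)` in `x²` and `y²`. -/
noncomputable def sinhCoeff (k : ℕ) : ℝ := 2 / ((2 * k + 1).factorial : ℝ)

/-- The power series of `2 sinh (x y) / (x y)` in `X = x²`, `Y = y²`. -/
noncomputable def sinhSeries (X Y : ℝ) : ℝ := ∑' k : ℕ, sinhCoeff k * X ^ k * Y ^ k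

lemma summable_sinhCoeff : Summable fun k : ℕ => |sinhCoeff k| * 2 ^ k * 2 ^ k := by
  refine (Real.hasSum_sinh 2).summable.congr fun k => ?_
  rw [sinhCoeff, abs_of_nonneg (by positivity), pow_succ, two_mul k, pow_add]
  ring

lemma two_mul_sinh_mul (x y : ℝ) :
    2 * Real.sinh (x * y) = x * y * sinhSeries (x ^ 2) (y ^ 2) := by
  rw [sinhSeries, Real.sinh_eq_tsum, ← tsum_mul_left, ← tsum_mul_left]
  refine tsum_congr fun k => ?_
  rw [sinhCoeff, pow_succ, pow_mul, mul_pow, mul_pow]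
  ring

lemma tsum_sinhCoeff (r s : ℕ) :
    ∑' k : ℕ, sinhCoeff k * (if k = r then 1 else 0) * (if k = s then 1 else 0)
      = if r = s then sinhCoeff r else 0 := by
  rw [tsum_eq_single r fun k hk => by simp [hk]]
  simp

lemma pOne_eq_sinh (x y : ℝ) :
    pOne 1 y x = (2 * Real.pi * 1) ^ (-(1 : ℝ) / 2) * Real.exp (-(x ^ 2 + y ^ 2) / 2)
      * (2 * Real.sinh (x * y)) := by
  simp only [pOne, heatK, Real.sinh_eq, mul_div_cancel₀ _ (two_ne_zero' ℝ), mul_sub (_ * _),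
    mul_assoc ((2 * Real.pi * 1) ^ (-(1 : ℝ) / 2)), ← Real.exp_add]
  congr 3 <;> ring

/-- The common factors of two kernels `G` and `G'` cancel in the ratio of their determinants. -/
lemma det_ratio_eq {G G' F F' : ℝ → ℝ → ℝ} {C : ℝ} (hC : C ≠ 0)
    (hG : ∀ x y, G y x = C * Real.exp (-(x ^ 2 + y ^ 2) / 2) * (x * y * F (x ^ 2) (y ^ 2)))
    (hG' : ∀ x y, G' y x = C * Real.exp (-(x ^ 2 + y ^ 2) / 2) * (x * y * F' (x ^ 2) (y ^ 2)))
    {x y : ℝ} (hx : 0 < x) (hxy : x < y) :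
    (F (x ^ 2) (x ^ 2) * F (y ^ 2) (y ^ 2) - F (x ^ 2) (y ^ 2) * F (y ^ 2) (x ^ 2))
        / (y ^ 2 - x ^ 2) ^ 2
      / ((F' (x ^ 2) (x ^ 2) * F' (y ^ 2) (y ^ 2) - F' (x ^ 2) (y ^ 2) * F' (y ^ 2) (x ^ 2))
        / (y ^ 2 - x ^ 2) ^ 2)
    = (G x x * G y y - G x y * G y x) / (G' x x * G' y y - G' x y * G' y x) := by
  have hs : y ^ 2 - x ^ 2 ≠ 0 := by nlinarith
  have det_eq {G F : ℝ → ℝ → ℝ}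
      (hG : ∀ x y, G y x = C * Real.exp (-(x ^ 2 + y ^ 2) / 2) * (x * y * F (x ^ 2) (y ^ 2))) :
      G x x * G y y - G x y * G y x
        = (C * Real.exp (-(x ^ 2 + y ^ 2) / 2) * (x * y)) ^ 2
        * (F (x ^ 2) (x ^ 2) * F (y ^ 2) (y ^ 2) - F (x ^ 2) (y ^ 2) * F (y ^ 2) (x ^ 2)) := by
    have e : Real.exp (-(x ^ 2 + x ^ 2) / 2) * Real.exp (-(y ^ 2 + y ^ 2) / 2)
        = Real.exp (-(x ^ 2 + y ^ 2) / 2) ^ 2 := by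
      rw [← Real.exp_add, ← Real.exp_nat_mul]
      congr 1
      push_cast
      ring
    rw [hG, hG, hG, hG, add_comm (y ^ 2) (x ^ 2)]
    linear_combination C ^ 2 * x ^ 2 * y ^ 2 * F (x ^ 2) (x ^ 2) * F (y ^ 2) (y ^ 2) * e
  have hk : (C * Real.exp (-(x ^ 2 + y ^ 2) / 2) * (x * y)) ^ 2 ≠ 0 :=
    pow_ne_zero 2 (mul_ne_zero (mul_ne_zero hC (Real.exp_pos _).ne')
      (mul_pos hx (hx.trans hxy)).ne')
  rw [div_div_div_cancel_right₀ (pow_ne_zero 2 hs), det_eq hG, det_eq hG', mul_div_mul_left _ _ hk]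

/-- For every `h > 0`, the limit of the Karlin-McGregor determinant ratio
`det[p₂ʰ(1,x_j|x_k)] / det[p₁(1,x_j|x_k)]` as `(x₁,x₂) → (0,0)` with
`0 < x₁ < x₂ < h` exists and equals
`∑_{(n₁,n₂) ∈ ℤ²} e^{-2h²(n₁²+n₂²)} A_h(n₁,n₂)`. -/
theorem limit_det_ratio (h : ℝ) (hh : 0 < h) :
    Tendsto
      (fun q : ℝ × ℝ =>
        (pTwo h 1 q.1 q.1 * pTwo h 1 q.2 q.2 - pTwo h 1 q.1 q.2 * pTwo h 1 q.2 q.1) /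
        (pOne 1 q.1 q.1 * pOne 1 q.2 q.2 - pOne 1 q.1 q.2 * pOne 1 q.2 q.1))
      (𝓝[{q : ℝ × ℝ | 0 < q.1 ∧ q.1 < q.2 ∧ q.2 < h}] (0, 0))
      (𝓝 (∑' n : ℤ × ℤ,
        Real.exp (-2 * h ^ 2 * ((n.1 : ℝ) ^ 2 + (n.2 : ℝ) ^ 2)) * Apoly h n.1 n.2)) := by
  have hsq : Tendsto (fun q : ℝ × ℝ => (q.1 ^ 2, q.2 ^ 2))
      (𝓝[{q : ℝ × ℝ | 0 < q.1 ∧ q.1 < q.2 ∧ q.2 < h}] (0, 0))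
      (𝓝[{q : ℝ × ℝ | 0 < q.1 ∧ q.1 < q.2}] (0, 0)) := by
    refine tendsto_nhdsWithin_iff.2 ⟨?_, ?_⟩
    · have hc : Continuous fun q : ℝ × ℝ => (q.1 ^ 2, q.2 ^ 2) := by fun_prop
      simpa using (hc.tendsto (0, 0)).mono_left nhdsWithin_le_nhds
    · filter_upwards [self_mem_nhdsWithin] with q hq
      exact ⟨pow_pos hq.1 2, pow_lt_pow_left₀ hq.2.1 hq.1.le two_ne_zero⟩
  have hnum := (tendsto_det_div_sq (F := imageSeries h) (summable_oddImageCoeff hh)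
    fun _ _ => rfl).comp hsq
  have hden := (tendsto_det_div_sq (F := sinhSeries) summable_sinhCoeff fun _ _ => rfl).comp hsq
  simp only [tsum_oddImageCoeff_zero_zero hh, tsum_oddImageCoeff_zero_one hh,
    tsum_oddImageCoeff_one_zero hh, tsum_oddImageCoeff_one_one hh] at hnum
  simp only [tsum_sinhCoeff] at hden
  have hlim := hnum.div hden (by simp [sinhCoeff, Nat.factorial_ne_zero])
  rw [(hasSum_Apoly hh).tsum_eq]
  convert! hlim.congr' ?_ using 2
  · norm_num [sinhCoeff, Nat.factorial]
    ring
  · filter_upwards [self_mem_nhdsWithin] with q hq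
    have hC : (2 * Real.pi * 1) ^ (-(1 : ℝ) / 2) ≠ 0 := by positivity
    refine det_ratio_eq (G := pTwo h 1) (G' := pOne 1) (F := imageSeries h)
      (F' := sinhSeries) hC (fun x y => ?_) (fun x y => ?_) hq.1 hq.2.1
    · rw [pTwo_eq_imageSum hh, imageSum_sub_eq hh]
    · rw [pOne_eq_sinh, two_mul_sinh_mul]
end

section
/- For every real s > 2, ∫₀^∞ h^s q₂(h) dh = (1/24)(π/2)^{s/2} s [ (s−1)(s²−2s+12) ∫₀^∞ u^{s/2−1}(θ(u)² − 1) du − 4(s+4)(s+6) ∫₀^∞ u^{s/2+1} θ'(u)² du + 64 ∫₀^∞ u^{s/2+3} θ''(u)² du ]. -/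
open MeasureTheory

/-- The Jacobi theta function `θ(u) = ∑_{n∈ℤ} e^{-πn²u}`. -/
noncomputable def jTheta (u : ℝ) : ℝ := ∑' n : ℤ, Real.exp (-Real.pi * (n : ℝ) ^ 2 * u)

/-- The polynomial `B_h(n₁,n₂)`. -/
noncomputable def Bpoly (h : ℝ) (n₁ n₂ : ℤ) : ℝ :=
  (8 / 3) * h * (-15 * (n₁ : ℝ) ^ 2 + 60 * h ^ 2 * (n₁ : ℝ) ^ 4
    + 60 * h ^ 2 * (n₁ : ℝ) ^ 2 * (n₂ : ℝ) ^ 2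
    - 60 * h ^ 4 * (n₁ : ℝ) ^ 6 - 180 * h ^ 4 * (n₁ : ℝ) ^ 4 * (n₂ : ℝ) ^ 2
    + 16 * h ^ 6 * (n₁ : ℝ) ^ 8 + 192 * h ^ 6 * (n₁ : ℝ) ^ 6 * (n₂ : ℝ) ^ 2
    - 80 * h ^ 6 * (n₁ : ℝ) ^ 4 * (n₂ : ℝ) ^ 4
    - 64 * h ^ 8 * (n₁ : ℝ) ^ 8 * (n₂ : ℝ) ^ 2
    + 64 * h ^ 8 * (n₁ : ℝ) ^ 6 * (n₂ : ℝ) ^ 4)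

/-- The density `q₂(h)` of the maximum height of two noncolliding Bessel bridges. -/
noncomputable def qTwo (h : ℝ) : ℝ :=
  ∑' n : {p : ℤ × ℤ // p ≠ (0, 0)},
    Real.exp (-2 * h ^ 2 * ((n.1.1 : ℝ) ^ 2 + (n.1.2 : ℝ) ^ 2)) * Bpoly h n.1.1 n.1.2

open Finset in
/-- `Γ(t + m) = t (t + 1) ⋯ (t + m - 1) Γ(t)`. -/
lemma Real.Gamma_add_natCast_eq_prod {t : ℝ} (ht : 0 < t) (m : ℕ) :
    Real.Gamma (t + m) = (∏ l ∈ range m, (t + l)) * Real.Gamma t := by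
  induction m with
  | zero => simp
  | succ m ih =>
    rw [Nat.cast_succ, ← add_assoc, Real.Gamma_add_one (by positivity), ih, prod_range_succ]
    ring

/-- The nonzero points of the lattice `ℤ²`. -/
abbrev NonzeroPair := {p : ℤ × ℤ // p ≠ (0, 0)}

namespace NonzeroPair

/-- The squared Euclidean norm of a lattice point. -/
def sqNorm (n : NonzeroPair) : ℝ := (n.1.1 : ℝ) ^ 2 + (n.1.2 : ℝ) ^ 2

lemma sqNorm_pos (n : NonzeroPair) : 0 < n.sqNorm := by
  obtain ⟨⟨a, b⟩, hn⟩ := n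
  have h : a ≠ 0 ∨ b ≠ 0 := by
    by_contra! h
    exact hn (by simp [h.1, h.2])
  unfold sqNorm
  rcases h with h | h
  · have : (a : ℝ) ≠ 0 := by exact_mod_cast h
    positivity
  · have : (b : ℝ) ≠ 0 := by exact_mod_cast h
    positivity

/-- Exchange of the two coordinates. -/
def swap : NonzeroPair ≃ NonzeroPair :=
  (Equiv.prodComm ℤ ℤ).subtypeEquiv fun p => by
    simp [Prod.ext_iff, and_comm]

lemma summable_sqNorm_rpow {t : ℝ} (ht : 1 < t) :
    Summable fun n : NonzeroPair => n.sqNorm ^ (-t) := by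
  have h := (EisensteinSeries.summable_one_div_norm_rpow
    (show 2 < 2 * t by linarith)).comp_injective
    ((finTwoArrowEquiv ℤ).symm.injective.comp
      (Subtype.val_injective (p := fun p : ℤ × ℤ => p ≠ (0, 0))))
  refine h.of_nonneg_of_le (fun n => Real.rpow_nonneg n.sqNorm_pos.le _) fun n => ?_
  simp only [Function.comp_apply]
  set x : Fin 2 → ℤ := (finTwoArrowEquiv ℤ).symm n.1 with hx
  have hx0 : x ≠ 0 := by
    intro h0
    apply n.2
    have : n.1 = finTwoArrowEquiv ℤ x := by simp [hx]
    rw [this, h0]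
    rfl
  have hle : ‖x‖ ≤ √n.sqNorm := by
    rw [pi_norm_le_iff_of_nonneg (Real.sqrt_nonneg _)]
    intro i
    rw [Int.norm_eq_abs]
    apply Real.abs_le_sqrt
    unfold sqNorm
    fin_cases i
    · simp [hx, sq_nonneg]
    · simp [hx, sq_nonneg]
  have hpos : 0 < ‖x‖ := norm_pos_iff.mpr hx0
  calc n.sqNorm ^ (-t) = (√n.sqNorm) ^ (-(2 * t)) := by
        rw [Real.sqrt_eq_rpow, ← Real.rpow_mul n.sqNorm_pos.le]
        congr 1
        ring
    _ ≤ ‖x‖ ^ (-(2 * t)) := Real.rpow_le_rpow_of_nonpos hpos hle (by linarith)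

end NonzeroPair

/-- The functions `f i` have integrals `v i` over `(0,∞)`, and the series of their `L¹` norms
converges. -/
structure TermwiseIntegrable {ι : Type*} (f : ι → ℝ → ℝ) (v : ι → ℝ) : Prop where
  integrableOn (i : ι) : IntegrableOn (f i) (Set.Ioi 0)
  integral_eq (i : ι) : ∫ x in Set.Ioi 0, f i x = v i
  summable_norm : Summable fun i => ∫ x in Set.Ioi 0, ‖f i x‖

namespace TermwiseIntegrable

variable {ι : Type*} {f g : ι → ℝ → ℝ} {v w : ι → ℝ}

lemma hasSum [Countable ι] (h : TermwiseIntegrable f v) :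
    HasSum v (∫ x in Set.Ioi 0, ∑' i, f i x) := by
  simpa only [h.integral_eq] using
    hasSum_integral_of_summable_integral_norm h.integrableOn h.summable_norm

lemma add (hf : TermwiseIntegrable f v) (hg : TermwiseIntegrable g w) :
    TermwiseIntegrable (fun i x => f i x + g i x) (fun i => v i + w i) where
  integrableOn i := (hf.integrableOn i).add (hg.integrableOn i)
  integral_eq i := by
    rw [integral_add (hf.integrableOn i) (hg.integrableOn i), hf.integral_eq, hg.integral_eq]
  summable_norm := by
    refine (hf.summable_norm.add hg.summable_norm).of_nonneg_of_le
      (fun i => integral_nonneg fun x => norm_nonneg _) fun i => ?_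
    rw [← integral_add (hf.integrableOn i).norm (hg.integrableOn i).norm]
    exact integral_mono ((hf.integrableOn i).add (hg.integrableOn i)).norm
      ((hf.integrableOn i).norm.add (hg.integrableOn i).norm) fun x => norm_add_le _ _

lemma const_mul (c : ℝ) (hf : TermwiseIntegrable f v) :
    TermwiseIntegrable (fun i x => c * f i x) (fun i => c * v i) where
  integrableOn i := (hf.integrableOn i).const_mul c
  integral_eq i := by rw [integral_const_mul, hf.integral_eq]
  summable_norm := by
    simp only [norm_mul, integral_const_mul]
    exact hf.summable_norm.mul_left _

end TermwiseIntegrable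

section Mellin

open NonzeroPair Finset

/-- Termwise Mellin transform of `∑ n₁^{2i} n₂^{2j} exp(-lam (n₁² + n₂²) x^p)`. -/
lemma termwiseIntegrable_monomial {t lam p q : ℝ} (i j : ℕ) (ht : 1 < t) (hlam : 0 < lam)
    (hp : 0 < p) (hq : (q + 1) / p = t + (i + j : ℕ)) :
    TermwiseIntegrable
      (fun (n : NonzeroPair) x => (n.1.1 : ℝ) ^ (2 * i) * (n.1.2 : ℝ) ^ (2 * j) *
        (x ^ q * Real.exp (-(lam * n.sqNorm) * x ^ p)))
      (fun n => ((n.1.1 : ℝ) ^ 2 / n.sqNorm) ^ i * ((n.1.2 : ℝ) ^ 2 / n.sqNorm) ^ j *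
        n.sqNorm ^ (-t) * (lam ^ (-t) / lam ^ (i + j) * (1 / p) *
          ((∏ l ∈ range (i + j), (t + l)) * Real.Gamma t))) := by
  have hq1 : -1 < q := by
    have : 0 < (q + 1) / p := by rw [hq]; positivity
    have := (div_pos_iff_of_pos_right hp).mp this
    linarith
  have hval (n : NonzeroPair) : ∫ x in Set.Ioi 0, (n.1.1 : ℝ) ^ (2 * i) * (n.1.2 : ℝ) ^ (2 * j) *
        (x ^ q * Real.exp (-(lam * n.sqNorm) * x ^ p)) =
      ((n.1.1 : ℝ) ^ 2 / n.sqNorm) ^ i * ((n.1.2 : ℝ) ^ 2 / n.sqNorm) ^ j *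
        n.sqNorm ^ (-t) * (lam ^ (-t) / lam ^ (i + j) * (1 / p) *
          ((∏ l ∈ range (i + j), (t + l)) * Real.Gamma t)) := by
    have hr := n.sqNorm_pos
    rw [integral_const_mul, integral_rpow_mul_exp_neg_mul_rpow hp hq1 (mul_pos hlam hr),
      neg_div, hq, Real.Gamma_add_natCast_eq_prod (by positivity),
      Real.mul_rpow hlam.le hr.le, neg_add, ← sub_eq_add_neg, Real.rpow_sub_natCast hlam.ne',
      Real.rpow_sub_natCast hr.ne', div_pow, div_pow, pow_mul, pow_mul, pow_add, pow_add]
    field_simp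
  refine ⟨fun n => (integrableOn_rpow_mul_exp_neg_mul_rpow hq1 hp
    (mul_pos hlam n.sqNorm_pos)).const_mul _, hval, ?_⟩
  have hnorm (n : NonzeroPair) : ∫ x in Set.Ioi 0, ‖(n.1.1 : ℝ) ^ (2 * i) *
      (n.1.2 : ℝ) ^ (2 * j) * (x ^ q * Real.exp (-(lam * n.sqNorm) * x ^ p))‖ = _ :=
    (setIntegral_congr_fun measurableSet_Ioi fun x (hx : 0 < x) => by
      refine Real.norm_of_nonneg ?_
      rw [pow_mul, pow_mul]
      positivity).trans (hval n)
  simp only [hnorm]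
  refine Summable.mul_right _ ((summable_sqNorm_rpow ht).of_nonneg_of_le
    (fun n => ?_) fun n => ?_)
  · have := n.sqNorm_pos
    positivity
  · have hr := n.sqNorm_pos
    refine mul_le_of_le_one_left (by positivity)
      (mul_le_one₀ (pow_le_one₀ (by positivity) ?_) (by positivity)
        (pow_le_one₀ (by positivity) ?_)) <;>
    · rw [div_le_one hr, sqNorm]
      nlinarith [sq_nonneg (n.1.1 : ℝ), sq_nonneg (n.1.2 : ℝ)]

/-- The `k`-th termwise derivative of the theta series. -/
noncomputable def jThetaDeriv (k : ℕ) (u : ℝ) : ℝ :=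
  ∑' n : ℤ, (-Real.pi * (n : ℝ) ^ 2) ^ k * Real.exp (-Real.pi * (n : ℝ) ^ 2 * u)

lemma summable_norm_jThetaDeriv_term (k : ℕ) {u : ℝ} (hu : 0 < u) :
    Summable fun n : ℤ =>
      ‖(-Real.pi * (n : ℝ) ^ 2) ^ k * Real.exp (-Real.pi * (n : ℝ) ^ 2 * u)‖ := by
  refine ((summable_pow_mul_jacobiTheta₂_term_bound 0 hu (2 * k)).mul_left
    (Real.pi ^ k)).congr fun n => ?_
  rw [norm_mul, norm_pow, norm_mul, norm_neg, Real.norm_of_nonneg Real.pi_pos.le,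
    Real.norm_of_nonneg (sq_nonneg _), Real.norm_of_nonneg (Real.exp_pos _).le, mul_pow, pow_mul,
    Int.cast_abs, sq_abs, ← mul_assoc]
  congr 2
  ring

lemma hasDerivAt_jThetaDeriv (k : ℕ) {u : ℝ} (hu : 0 < u) :
    HasDerivAt (jThetaDeriv k) (jThetaDeriv (k + 1) u) u := by
  refine hasDerivAt_tsum_of_isPreconnected
    (g := fun (n : ℤ) u => (-Real.pi * (n : ℝ) ^ 2) ^ k * Real.exp (-Real.pi * (n : ℝ) ^ 2 * u))
    (g' := fun (n : ℤ) u =>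
      (-Real.pi * (n : ℝ) ^ 2) ^ (k + 1) * Real.exp (-Real.pi * (n : ℝ) ^ 2 * u))
    (summable_norm_jThetaDeriv_term (k + 1) (half_pos hu)) (t := Set.Ioi (u / 2)) isOpen_Ioi
    isPreconnected_Ioi (fun n y _ => ?_) (fun n y hy => ?_) (y₀ := u) (half_lt_self hu)
    (summable_norm_jThetaDeriv_term k hu).of_norm (half_lt_self hu)
  · have h := (((hasDerivAt_id y).const_mul (-Real.pi * (n : ℝ) ^ 2)).exp).const_mul
      ((-Real.pi * (n : ℝ) ^ 2) ^ k)
    refine h.congr_deriv ?_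
    simp only [id]
    ring
  · rw [norm_mul, norm_mul]
    refine mul_le_mul_of_nonneg_left ?_ (norm_nonneg _)
    rw [Real.norm_of_nonneg (Real.exp_pos _).le, Real.norm_of_nonneg (Real.exp_pos _).le,
      Real.exp_le_exp]
    have : (0 : ℝ) ≤ Real.pi * (n : ℝ) ^ 2 := by positivity
    nlinarith [Set.mem_Ioi.mp hy]

lemma jTheta_eq_jThetaDeriv : jTheta = jThetaDeriv 0 := by
  ext u
  simp [jTheta, jThetaDeriv]

lemma deriv_jTheta {u : ℝ} (hu : 0 < u) : deriv jTheta u = jThetaDeriv 1 u := by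
  rw [jTheta_eq_jThetaDeriv]
  exact (hasDerivAt_jThetaDeriv 0 hu).deriv

lemma deriv_deriv_jTheta {u : ℝ} (hu : 0 < u) : deriv (deriv jTheta) u = jThetaDeriv 2 u := by
  have h : deriv jTheta =ᶠ[nhds u] jThetaDeriv 1 := by
    filter_upwards [Ioi_mem_nhds hu] with x hx using deriv_jTheta hx
  rw [h.deriv_eq]
  exact (hasDerivAt_jThetaDeriv 1 hu).deriv

lemma jThetaDeriv_sq_sub (k : ℕ) {u : ℝ} (hu : 0 < u) :
    jThetaDeriv k u ^ 2 - 0 ^ k = ∑' n : NonzeroPair, Real.pi ^ (2 * k) *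
      ((n.1.1 : ℝ) ^ (2 * k) * (n.1.2 : ℝ) ^ (2 * k) *
        Real.exp (-(Real.pi * n.sqNorm) * u)) := by
  have hs := summable_norm_jThetaDeriv_term k hu
  have hsplit := (summable_mul_of_summable_norm hs hs).tsum_subtype_add_tsum_subtype_compl
    {((0 : ℤ), (0 : ℤ))}
  rw [tsum_singleton ((0 : ℤ), (0 : ℤ)) (fun z : ℤ × ℤ =>
      ((-Real.pi * (z.1 : ℝ) ^ 2) ^ k * Real.exp (-Real.pi * (z.1 : ℝ) ^ 2 * u)) *
      ((-Real.pi * (z.2 : ℝ) ^ 2) ^ k * Real.exp (-Real.pi * (z.2 : ℝ) ^ 2 * u))),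
    ← tsum_mul_tsum_of_summable_norm hs hs] at hsplit
  have hzero : (0 : ℝ) ^ k * 0 ^ k = 0 ^ k := by
    rw [← mul_pow, mul_zero]
  simp only [Int.cast_zero, ne_eq, OfNat.ofNat_ne_zero, not_false_eq_true, zero_pow, mul_zero,
    zero_mul, Real.exp_zero, mul_one, hzero] at hsplit
  rw [sq, jThetaDeriv, ← hsplit, add_sub_cancel_left]
  refine tsum_congr fun n : NonzeroPair => ?_
  rw [show -(Real.pi * n.sqNorm) * u = -Real.pi * (n.1.1 : ℝ) ^ 2 * u +
    -Real.pi * (n.1.2 : ℝ) ^ 2 * u by rw [sqNorm]; ring, Real.exp_add, mul_pow, mul_pow,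
    ← pow_mul, ← pow_mul, mul_comm 2 k, pow_mul Real.pi k 2, neg_pow]
  have : ((-1 : ℝ) ^ k) * (-1) ^ k = 1 := by rw [← mul_pow]; simp
  linear_combination (Real.pi ^ k * Real.pi ^ k * (n.1.1 : ℝ) ^ (k * 2) *
    (n.1.2 : ℝ) ^ (k * 2) * Real.exp (-Real.pi * (n.1.1 : ℝ) ^ 2 * u) *
    Real.exp (-Real.pi * (n.1.2 : ℝ) ^ 2 * u)) * this

/-- The Mellin transform of the square of a derivative of the theta function, as a lattice sum. -/
lemma hasSum_integral_jThetaDeriv_sq (k : ℕ) {t q : ℝ} (ht : 1 < t) (hq : q = t - 1 + 2 * k) :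
    HasSum (fun n : NonzeroPair =>
      ((n.1.1 : ℝ) ^ 2 / n.sqNorm) ^ k * ((n.1.2 : ℝ) ^ 2 / n.sqNorm) ^ k * n.sqNorm ^ (-t) *
        (Real.pi ^ (-t) * ((∏ l ∈ range (k + k), (t + l)) * Real.Gamma t)))
      (∫ u in Set.Ioi 0, u ^ q * (jThetaDeriv k u ^ 2 - 0 ^ k)) := by
  have h := ((termwiseIntegrable_monomial (p := 1) (q := q) k k ht Real.pi_pos one_pos
    (by rw [hq]; push_cast; ring)).const_mul (Real.pi ^ (2 * k))).hasSum
  convert h using 1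
  · ext n
    rw [← two_mul]
    field_simp
  · refine setIntegral_congr_fun measurableSet_Ioi fun u (hu : 0 < u) => ?_
    rw [jThetaDeriv_sq_sub k hu, ← tsum_mul_left]
    refine tsum_congr fun n => ?_
    rw [Real.rpow_one]
    ring

/-- The contribution of a single lattice point with `n₁²/(n₁²+n₂²) = x` and
`n₂²/(n₁²+n₂²) = y` to the moment of order `2 t`, up to the factor
`(n₁²+n₂²)^{-t} 2^{-t} Γ(t)`. -/
noncomputable def momentWeight (t x y : ℝ) : ℝ :=
  (t / 3) * (-30 * x + (60 * x ^ 2 + 60 * x * y) * (t + 1)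
    - (30 * x ^ 3 + 90 * x ^ 2 * y) * ((t + 1) * (t + 2))
    + (4 * x ^ 4 + 48 * x ^ 3 * y - 20 * x ^ 2 * y ^ 2) * ((t + 1) * (t + 2) * (t + 3))
    + (-8 * x ^ 4 * y + 8 * x ^ 3 * y ^ 2) * ((t + 1) * (t + 2) * (t + 3) * (t + 4)))

lemma hasSum_integral_rpow_mul_qTwo {s : ℝ} (hs : 2 < s) :
    HasSum (fun n : NonzeroPair => n.sqNorm ^ (-(s / 2)) * (2 ^ (-(s / 2)) *
        Real.Gamma (s / 2)) *
        momentWeight (s / 2) ((n.1.1 : ℝ) ^ 2 / n.sqNorm) ((n.1.2 : ℝ) ^ 2 / n.sqNorm))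
      (∫ h in Set.Ioi 0, h ^ s * qTwo h) := by
  have M (i j : ℕ) := termwiseIntegrable_monomial (lam := 2) (p := 2)
    (q := s + 2 * (i + j : ℕ) - 1) i j (show 1 < s / 2 by linarith) two_pos two_pos (by ring)
  have h := (((((((((((M 1 0).const_mul (-15)).add ((M 2 0).const_mul 60)).add
    ((M 1 1).const_mul 60)).add ((M 3 0).const_mul (-60))).add ((M 2 1).const_mul (-180))).add
    ((M 4 0).const_mul 16)).add ((M 3 1).const_mul 192)).add ((M 2 2).const_mul (-80))).add
    ((M 4 1).const_mul (-64))).add ((M 3 2).const_mul 64)).const_mul (8 / 3) |>.hasSum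
  convert h using 1
  · ext n
    simp only [momentWeight, prod_range_succ, prod_range_zero, Nat.reduceAdd, Nat.cast_zero,
      Nat.cast_one, Nat.cast_ofNat, add_zero, pow_zero, mul_one, one_mul]
    ring
  · refine setIntegral_congr_fun measurableSet_Ioi fun x (hx : 0 < x) => ?_
    have hpow (m : ℕ) : x ^ (s + 2 * ((m + 1 : ℕ) : ℝ) - 1) = x ^ s * x ^ (2 * m + 1) := by
      rw [← Real.rpow_natCast x (2 * m + 1), ← Real.rpow_add hx]
      congr 1
      push_cast
      ring
    have e1 := hpow 0
    have e2 := hpow 1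
    have e3 := hpow 2
    have e4 := hpow 3
    have e5 := hpow 4
    simp only [Nat.reduceAdd, zero_add] at e1 e2 e3 e4 e5
    simp only [qTwo, ← tsum_mul_left]
    refine tsum_congr fun n : NonzeroPair => ?_
    simp only [Nat.reduceAdd, e1, e2, e3, e4, e5, Real.rpow_two, Bpoly, add_zero]
    rw [show -(2 * n.sqNorm) * x ^ 2 = -2 * x ^ 2 * ((n.1.1 : ℝ) ^ 2 + (n.1.2 : ℝ) ^ 2) by
      rw [sqNorm]; ring]
    ring

lemma momentWeight_add_swap (t : ℝ) {x y : ℝ} (hxy : x + y = 1) :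
    momentWeight t x y + momentWeight t y x =
      (t / 6) * ((2 * t - 1) * (4 * t ^ 2 - 4 * t + 12)
        - 4 * (2 * t + 4) * (2 * t + 6) * (t * (t + 1)) * (x * y)
        + 64 * (t * (t + 1) * (t + 2) * (t + 3)) * (x ^ 2 * y ^ 2)) := by
  obtain rfl : y = 1 - x := by linarith
  unfold momentWeight
  ring

end Mellin

/-- For every real `s > 2`, the `s`-th moment of `H₂` expressed by integrals of
the Jacobi theta function and its derivatives over `(0,∞)`. -/
theorem moment_H2_theta (s : ℝ) (hs : 2 < s) :
    (∫ h in Set.Ioi (0 : ℝ), h ^ s * qTwo h)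
      = (1 / 24) * (Real.pi / 2) ^ (s / 2) * s *
        ((s - 1) * (s ^ 2 - 2 * s + 12) *
            (∫ u in Set.Ioi (0 : ℝ), u ^ (s / 2 - 1) * ((jTheta u) ^ 2 - 1))
          - 4 * (s + 4) * (s + 6) *
            (∫ u in Set.Ioi (0 : ℝ), u ^ (s / 2 + 1) * (deriv jTheta u) ^ 2)
          + 64 * ∫ u in Set.Ioi (0 : ℝ), u ^ (s / 2 + 3) * (deriv (deriv jTheta) u) ^ 2) := by
  have ht : 1 < s / 2 := by linarith
  have hL := hasSum_integral_rpow_mul_qTwo hs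
  have h0 := hasSum_integral_jThetaDeriv_sq 0 ht (q := s / 2 - 1) (by push_cast; ring)
  have h1 := hasSum_integral_jThetaDeriv_sq 1 ht (q := s / 2 + 1) (by push_cast; ring)
  have h2 := hasSum_integral_jThetaDeriv_sq 2 ht (q := s / 2 + 3) (by push_cast; ring)
  have hswap := (NonzeroPair.swap.hasSum_iff).mpr hL
  have hR := (((h0.mul_left ((s - 1) * (s ^ 2 - 2 * s + 12))).sub
    (h1.mul_left (4 * (s + 4) * (s + 6)))).add (h2.mul_left 64)).mul_left
      ((1 / 24) * (Real.pi / 2) ^ (s / 2) * s)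
  have hsum := (hL.add hswap).div_const 2
  rw [add_self_div_two] at hsum
  have e1 : ∫ u in Set.Ioi (0 : ℝ), u ^ (s / 2 + 1) * (deriv jTheta u) ^ 2 =
      ∫ u in Set.Ioi (0 : ℝ), u ^ (s / 2 + 1) * (jThetaDeriv 1 u ^ 2 - 0 ^ 1) :=
    setIntegral_congr_fun measurableSet_Ioi fun u hu => by simp [deriv_jTheta hu]
  have e2 : ∫ u in Set.Ioi (0 : ℝ), u ^ (s / 2 + 3) * (deriv (deriv jTheta) u) ^ 2 =
      ∫ u in Set.Ioi (0 : ℝ), u ^ (s / 2 + 3) * (jThetaDeriv 2 u ^ 2 - 0 ^ 2) :=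
    setIntegral_congr_fun measurableSet_Ioi fun u hu => by simp [deriv_deriv_jTheta hu]
  rw [e1, e2, jTheta_eq_jThetaDeriv]
  simp only [pow_zero] at hR
  refine hsum.unique (hR.congr_fun fun n => ?_)
  have hr := n.sqNorm_pos
  have hxy : (n.1.1 : ℝ) ^ 2 / n.sqNorm + (n.1.2 : ℝ) ^ 2 / n.sqNorm = 1 := by
    rw [← add_div]
    exact div_self hr.ne'
  have hsw : (NonzeroPair.swap n).sqNorm = n.sqNorm := add_comm _ _
  have hw := momentWeight_add_swap (s / 2) hxy
  have hpi : (Real.pi / 2) ^ (s / 2) * Real.pi ^ (-(s / 2)) = 2 ^ (-(s / 2)) := by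
    rw [Real.div_rpow Real.pi_pos.le two_pos.le, Real.rpow_neg Real.pi_pos.le,
      Real.rpow_neg two_pos.le]
    field_simp
  have hx' : ((NonzeroPair.swap n).1.1 : ℝ) = n.1.2 := rfl
  have hy' : ((NonzeroPair.swap n).1.2 : ℝ) = n.1.1 := rfl
  simp only [Function.comp_apply, hsw, hx', hy', Finset.prod_range_succ, Finset.prod_range_zero,
    Nat.reduceAdd, Nat.cast_zero, Nat.cast_one, Nat.cast_ofNat, add_zero, pow_one]
  rw [← mul_add, hw, ← hpi]
  ring
end
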